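/- arXiv:math/0602366 — 7 statements merged into one kernel-verified Lean document; each statement's English description precedes it below -/
import Mathlib

section
/- Let M = (M_j)_{j≥0} be a strongly regular sequence. Then for every real s ≥ 1 there exists a constant ρ(s) ≥ 1, depending only on s and M, such that h_M(t) ≤ (h_M(ρ(s)·t))^s for every t ≥ 0. -/
noncomputable section

open Filter MeasureTheory
open scoped Topology

def StronglyRegularWith (M : ℕ → ℝ) (A : ℝ) : Prop :=
  (∀ j, 0 < M j) ∧ M 0 = 1 ∧ Monotone M ∧
  (∀ j : ℕ, M (j + 1) * M (j + 1) ≤ M j * M (j + 2)) ∧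
  1 ≤ A ∧
  (∀ j k : ℕ, M (j + k) ≤ A ^ (j + k) * (M j * M k)) ∧
  (∀ ℓ N : ℕ, ∑ j ∈ Finset.range N,
      M (ℓ + j) / (((ℓ + j : ℕ) + 1 : ℝ) * M (ℓ + j + 1)) ≤ A * (M ℓ / M (ℓ + 1)))

def StronglyRegular (M : ℕ → ℝ) : Prop := ∃ A : ℝ, StronglyRegularWith M A

noncomputable def hfn (M : ℕ → ℝ) (t : ℝ) : ℝ :=
  if t = 0 then 0 else ⨅ j : ℕ, t ^ j * M j

def PropertyP (M : ℕ → ℝ) (γ : ℝ) : Prop :=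
  ∃ (m' : ℕ → ℝ) (a : ℝ), 1 ≤ a ∧ (∀ j, 0 < m' j) ∧
    (Monotone fun j : ℕ => ((j : ℝ) + 1) ^ (-γ) * m' j) ∧
    (∀ j : ℕ, a⁻¹ * (M (j + 1) / M j) ≤ m' j ∧ m' j ≤ a * (M (j + 1) / M j))

noncomputable def growthIndex (M : ℕ → ℝ) : ℝ :=
  sSup {γ : ℝ | 0 < γ ∧ PropertyP M γ}

def Sector (γ : ℝ) : Set ℂ :=
  {z : ℂ | z ≠ 0 ∧ |Complex.arg z| < γ * Real.pi / 2}

noncomputable def mixedPartial {n : ℕ} {F : Type*} [NormedAddCommGroup F] [NormedSpace ℝ F]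
    (S : Set (EuclideanSpace ℝ (Fin n))) (f : EuclideanSpace ℝ (Fin n) → F)
    (k : ℕ) (e : Fin k → Fin n) (x : EuclideanSpace ℝ (Fin n)) : F :=
  iteratedFDerivWithin ℝ k f S x fun i => EuclideanSpace.single (e i) 1

theorem hfn_nonneg {M : ℕ → ℝ} (hpos : ∀ j, 0 < M j) {t : ℝ} (ht : 0 ≤ t) : 0 ≤ hfn M t := by
  unfold hfn
  split_ifs
  · exact le_rfl
  · exact Real.iInf_nonneg fun j => mul_nonneg (pow_nonneg ht j) (hpos j).le

theorem hfn_le_pow_mul {M : ℕ → ℝ} (hpos : ∀ j, 0 < M j) {t : ℝ} (ht : 0 ≤ t) (j : ℕ) :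
    hfn M t ≤ t ^ j * M j := by
  unfold hfn
  split_ifs
  · exact mul_nonneg (pow_nonneg ht j) (hpos j).le
  · refine ciInf_le ⟨0, ?_⟩ j
    rintro _ ⟨i, rfl⟩
    exact mul_nonneg (pow_nonneg ht i) (hpos i).le

theorem hfn_le_one {M : ℕ → ℝ} (hpos : ∀ j, 0 < M j) (h0 : M 0 = 1) {t : ℝ} (ht : 0 ≤ t) :
    hfn M t ≤ 1 := by
  simpa [h0] using hfn_le_pow_mul hpos ht 0

theorem le_hfn {M : ℕ → ℝ} {t c : ℝ} (ht : 0 < t) (hc : ∀ j, c ≤ t ^ j * M j) :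
    c ≤ hfn M t := by
  rw [hfn, if_neg ht.ne']
  exact le_ciInf hc

/-- Moderate growth of `M` gives a doubling of the exponent of `h_M`. -/
theorem hfn_le_sq_of_moderate_growth {M : ℕ → ℝ} {A : ℝ} (hpos : ∀ j, 0 < M j) (hA : 1 ≤ A)
    (hmg : ∀ j k : ℕ, M (j + k) ≤ A ^ (j + k) * (M j * M k)) {t : ℝ} (ht : 0 ≤ t) :
    hfn M t ≤ hfn M (A * t) ^ 2 := by
  rcases ht.eq_or_lt with rfl | ht
  · simp [hfn]
  have hAt : 0 < A * t := mul_pos (by linarith) ht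
  have term_pos (j : ℕ) : 0 < (A * t) ^ j * M j := mul_pos (pow_pos hAt j) (hpos j)
  have le_term_mul_term (j k : ℕ) :
      hfn M t ≤ ((A * t) ^ j * M j) * ((A * t) ^ k * M k) :=
    calc hfn M t ≤ t ^ (j + k) * M (j + k) := hfn_le_pow_mul hpos ht.le _
      _ ≤ t ^ (j + k) * (A ^ (j + k) * (M j * M k)) := by gcongr; exact hmg j k
      _ = _ := by ring
  have le_hfn_mul_term (k : ℕ) : hfn M t ≤ hfn M (A * t) * ((A * t) ^ k * M k) := by
    rw [← div_le_iff₀ (term_pos k)]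
    exact le_hfn hAt fun j => (div_le_iff₀ (term_pos k)).2 (le_term_mul_term j k)
  rcases (hfn_nonneg hpos hAt.le).eq_or_lt with h | h
  · simpa [← h] using le_hfn_mul_term 0
  · rw [sq, ← div_le_iff₀' h]
    exact le_hfn hAt fun k => (div_le_iff₀' h).2 (le_hfn_mul_term k)

theorem hfn_le_two_pow_of_moderate_growth {M : ℕ → ℝ} {A : ℝ} (hpos : ∀ j, 0 < M j)
    (hA : 1 ≤ A) (hmg : ∀ j k : ℕ, M (j + k) ≤ A ^ (j + k) * (M j * M k)) (n : ℕ)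
    {t : ℝ} (ht : 0 ≤ t) : hfn M t ≤ hfn M (A ^ n * t) ^ 2 ^ n := by
  induction n with
  | zero => simp
  | succ n ih =>
    have hnt : 0 ≤ A ^ n * t := mul_nonneg (pow_nonneg (by linarith) n) ht
    calc hfn M t ≤ hfn M (A ^ n * t) ^ 2 ^ n := ih
      _ ≤ (hfn M (A * (A ^ n * t)) ^ 2) ^ 2 ^ n :=
        pow_le_pow_left₀ (hfn_nonneg hpos hnt)
          (hfn_le_sq_of_moderate_growth hpos hA hmg hnt) _
      _ = hfn M (A ^ (n + 1) * t) ^ 2 ^ (n + 1) := by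
        rw [← pow_mul, ← mul_assoc, ← pow_succ', ← pow_succ']

/-- for a strongly regular sequence `M` and any real `s ≥ 1` there is
`ρ(s) ≥ 1` with `h_M(t) ≤ (h_M(ρ(s) t))^s` for all `t ≥ 0`. -/
theorem stmt1 (M : ℕ → ℝ) (hM : StronglyRegular M) (s : ℝ) (hs : 1 ≤ s) :
    ∃ ρ : ℝ, 1 ≤ ρ ∧ ∀ t : ℝ, 0 ≤ t → hfn M t ≤ hfn M (ρ * t) ^ s := by
  obtain ⟨A, hpos, h0, -, -, hA, hmg, -⟩ := hM
  obtain ⟨n, hn⟩ := pow_unbounded_of_one_lt s one_lt_two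
  refine ⟨A ^ n, one_le_pow₀ hA, fun t ht => ?_⟩
  have hnt : 0 ≤ A ^ n * t := mul_nonneg (pow_nonneg (by linarith) n) ht
  refine (hfn_le_two_pow_of_moderate_growth hpos hA hmg n ht).trans ?_
  rw [← Real.rpow_natCast]
  exact Real.rpow_le_rpow_of_exponent_ge_of_imp (hfn_nonneg hpos hnt) (hfn_le_one hpos h0 hnt)
    (by push_cast; exact hn.le) fun _ h => absurd h (by positivity)
end
end

section
/- Let M = (M_j)_{j≥0} be a strongly regular sequence. Then there exist constants δ > 0 and a₂ > 0 such that M_j ≤ a₂^j · (j!)^δ for every j ∈ ℕ. -/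
noncomputable section

open Filter MeasureTheory
open scoped Topology

theorem two_pow_mul_factorial_mul_factorial_le {i m : ℕ} (h : i ≤ m) :
    2 ^ i * i.factorial * m.factorial ≤ (i + m).factorial := by
  induction i with
  | zero => simp
  | succ i ih =>
    have e : i + 1 + m = (i + m) + 1 := by ring
    rw [e, Nat.factorial_succ, Nat.factorial_succ]
    calc 2 ^ (i + 1) * ((i + 1) * i.factorial) * m.factorial
        = (2 * (i + 1)) * (2 ^ i * i.factorial * m.factorial) := by ring
      _ ≤ (i + m + 1) * (i + m).factorial :=
        Nat.mul_le_mul (by omega) (ih (by omega))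

theorem le_pow_mul_factorial_pow_of_moderate_growth {M : ℕ → ℝ} {A : ℝ} {k : ℕ}
    (hpos : ∀ j, 0 < M j) (h0 : M 0 = 1) (hA : 1 ≤ A)
    (hmg : ∀ i j : ℕ, M (i + j) ≤ A ^ (i + j) * (M i * M j)) (hk : A ^ 3 ≤ 2 ^ k) (n : ℕ) :
    M n ≤ M 1 ^ n * (n.factorial : ℝ) ^ k := by
  induction n using Nat.strong_induction_on with
  | _ n ih =>
    rcases Nat.lt_or_ge n 2 with hn | hn
    · interval_cases n <;> simp [h0]
    · obtain ⟨i, m, rfl, him, hi, hm⟩ : ∃ i m, n = i + m ∧ i ≤ m ∧ 1 ≤ i ∧ m ≤ 2 * i :=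
        ⟨n / 2, n - n / 2, by omega, by omega, by omega, by omega⟩
      have hB := hpos 1
      have hApow : A ^ (i + m) ≤ (2 ^ k) ^ i :=
        calc A ^ (i + m) ≤ A ^ (3 * i) := pow_le_pow_right₀ hA (by omega)
          _ = (A ^ 3) ^ i := pow_mul _ _ _
          _ ≤ (2 ^ k) ^ i := by gcongr
      have hfac : (2 : ℝ) ^ i * i.factorial * m.factorial ≤ (i + m).factorial := by
        exact_mod_cast two_pow_mul_factorial_mul_factorial_le him
      calc M (i + m) ≤ A ^ (i + m) * (M i * M m) := hmg i m
        _ ≤ (2 ^ k) ^ i * ((M 1 ^ i * (i.factorial : ℝ) ^ k) *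
              (M 1 ^ m * (m.factorial : ℝ) ^ k)) :=
          mul_le_mul hApow
            (mul_le_mul (ih i (by omega)) (ih m (by omega)) (hpos m).le (by positivity))
            (mul_pos (hpos i) (hpos m)).le (by positivity)
        _ = M 1 ^ (i + m) * ((2 : ℝ) ^ i * i.factorial * m.factorial) ^ k := by ring
        _ ≤ M 1 ^ (i + m) * ((i + m).factorial : ℝ) ^ k := by gcongr

/-- every strongly regular sequence satisfies `M_j ≤ a₂^j (j!)^δ`
for some constants `δ > 0` and `a₂ > 0`. -/
theorem stmt3 (M : ℕ → ℝ) (hM : StronglyRegular M) :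
    ∃ δ a₂ : ℝ, 0 < δ ∧ 0 < a₂ ∧
      ∀ j : ℕ, M j ≤ a₂ ^ j * (Nat.factorial j : ℝ) ^ δ := by
  obtain ⟨A, hpos, h0, -, -, hA, hmg, -⟩ := hM
  obtain ⟨k, hk⟩ := pow_unbounded_of_one_lt (A ^ 3) (one_lt_two : (1 : ℝ) < 2)
  have hk' : A ^ 3 ≤ 2 ^ (k + 1) :=
    hk.le.trans (pow_le_pow_right₀ one_le_two k.le_succ)
  refine ⟨(k + 1 : ℕ), M 1, by positivity, hpos 1, fun j => ?_⟩
  rw [Real.rpow_natCast]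
  exact le_pow_mul_factorial_pow_of_moderate_growth hpos h0 hA hmg hk' j
end
end

section
/- Let M = (M_j)_{j≥0} be a strongly regular sequence and let s > 0 be a real number. Then the sequence M^s = (M_j^s)_{j≥0} is also strongly regular, and h_{M^s}(t^s) = (h_M(t))^s for every t ≥ 0. -/
noncomputable section

open Filter MeasureTheory
open scoped Topology

/-- Tangent-line inequality for the concave function `x ↦ x ^ s` with `0 ≤ s ≤ 1`. -/
theorem rpow_add_mul_rpow_sub_one_le {s x y : ℝ} (hs0 : 0 ≤ s) (hs1 : s ≤ 1)
    (hx : 0 ≤ x) (hy : 0 < y) :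
    x ^ s + s * y ^ (s - 1) * (y - x) ≤ y ^ s := by
  have hb := rpow_one_add_le_one_add_mul_self (s := (x - y) / y)
    (by rw [le_div_iff₀ hy]; linarith) hs0 hs1
  rw [show 1 + (x - y) / y = x / y by field_simp; ring,
    Real.div_rpow hx hy.le, div_le_iff₀ (Real.rpow_pos_of_pos hy s)] at hb
  rw [Real.rpow_sub_one hy.ne']
  have e : (1 + s * ((x - y) / y)) * y ^ s = y ^ s - s * (y ^ s / y) * (y - x) := by
    field_simp
    ring
  linarith

/-- If the weighted tails of `u` are dominated by `u`, then for `0 < s ≤ 1` the weighted tails of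
`u ^ s` are dominated by the `s`-th powers of those of `u`. -/
theorem sum_mul_rpow_le_of_sum_le {u w : ℕ → ℝ} {A s : ℝ} (hu : ∀ j, 0 < u j)
    (hw : ∀ j, 0 < w j) (hA : 0 < A) (hs : 0 < s) (hs1 : s ≤ 1)
    (h : ∀ l N : ℕ, ∑ j ∈ Finset.range N, w (l + j) * u (l + j) ≤ A * u l) (N l : ℕ) :
    ∑ j ∈ Finset.range N, w (l + j) * u (l + j) ^ s ≤
      A ^ (1 - s) / s * (∑ j ∈ Finset.range N, w (l + j) * u (l + j)) ^ s := by
  induction N generalizing l with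
  | zero => simp [Real.zero_rpow hs.ne']
  | succ N ih =>
    have hshift (v : ℕ → ℝ) : ∑ j ∈ Finset.range (N + 1), v (l + j) =
        ∑ j ∈ Finset.range N, v (l + 1 + j) + v l := by
      rw [Finset.sum_range_succ']
      simp only [add_zero, add_assoc, add_comm 1]
    have htail := h l (N + 1)
    rw [hshift fun j => w j * u j] at htail
    rw [hshift fun j => w j * u j, hshift fun j => w j * u j ^ s]
    set x := ∑ j ∈ Finset.range N, w (l + 1 + j) * u (l + 1 + j)
    have hx : 0 ≤ x := Finset.sum_nonneg fun j _ => (mul_pos (hw _) (hu _)).le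
    have hwu : 0 < w l * u l := mul_pos (hw l) (hu l)
    have hy : 0 < x + w l * u l := by linarith
    have htan := rpow_add_mul_rpow_sub_one_le hs.le hs1 hx hy
    rw [add_sub_cancel_left] at htan
    have hpow : A ^ (s - 1) * u l ^ (s - 1) ≤ (x + w l * u l) ^ (s - 1) := by
      rw [← Real.mul_rpow hA.le (hu l).le]
      exact Real.rpow_le_rpow_of_nonpos hy htail (by linarith)
    have hterm : w l * u l ^ s ≤
        A ^ (1 - s) / s * (s * (x + w l * u l) ^ (s - 1) * (w l * u l)) := by
      calc w l * u l ^ s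
          = A ^ (1 - s) * (A ^ (s - 1) * u l ^ (s - 1)) * (w l * u l) := by
            have e1 : A ^ (1 - s) * A ^ (s - 1) = 1 := by
              rw [← Real.rpow_add hA]; simp
            have e2 : u l ^ (s - 1) * u l = u l ^ s := by
              rw [Real.rpow_sub_one (hu l).ne', div_mul_cancel₀ _ (hu l).ne']
            linear_combination (-w l * u l ^ (s - 1) * u l) * e1 - w l * e2
        _ ≤ A ^ (1 - s) * (x + w l * u l) ^ (s - 1) * (w l * u l) := by gcongr
        _ = _ := by field_simp
    have hC : 0 < A ^ (1 - s) / s := by positivity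
    have := mul_le_mul_of_nonneg_left htan hC.le
    linarith [ih (l + 1)]

theorem sum_mul_rpow_le_of_sum_le_of_antitone {u w : ℕ → ℝ} {A s : ℝ} (hu : ∀ j, 0 < u j)
    (hanti : Antitone u) (hw : ∀ j, 0 < w j) (hA : 0 < A) (hs : 0 < s)
    (h : ∀ l N : ℕ, ∑ j ∈ Finset.range N, w (l + j) * u (l + j) ≤ A * u l) (l N : ℕ) :
    ∑ j ∈ Finset.range N, w (l + j) * u (l + j) ^ s ≤ (A + A / s) * u l ^ s := by
  have hus := Real.rpow_pos_of_pos (hu l) s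
  rcases le_total s 1 with hs1 | hs1
  · calc _ ≤ A ^ (1 - s) / s * (∑ j ∈ Finset.range N, w (l + j) * u (l + j)) ^ s :=
          sum_mul_rpow_le_of_sum_le hu hw hA hs hs1 h N l
      _ ≤ A ^ (1 - s) / s * (A * u l) ^ s := by
          gcongr
          · exact Finset.sum_nonneg fun j _ => (mul_pos (hw _) (hu _)).le
          · exact h l N
      _ = A / s * u l ^ s := by
          rw [Real.mul_rpow hA.le (hu l).le]
          have e : A ^ (1 - s) * A ^ s = A := by
            rw [← Real.rpow_add hA]; simp
          linear_combination (u l ^ s / s) * e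
      _ ≤ _ := by gcongr; linarith
  · calc _ ≤ ∑ j ∈ Finset.range N, u l ^ (s - 1) * (w (l + j) * u (l + j)) := by
          refine Finset.sum_le_sum fun j _ => ?_
          have e : u (l + j) ^ s = u (l + j) ^ (s - 1) * u (l + j) := by
            rw [Real.rpow_sub_one (hu _).ne', div_mul_cancel₀ _ (hu _).ne']
          have hle : u (l + j) ^ (s - 1) ≤ u l ^ (s - 1) :=
            Real.rpow_le_rpow (hu _).le (hanti (Nat.le_add_right l j)) (by linarith)
          have := mul_le_mul_of_nonneg_right hle (mul_pos (hw (l + j)) (hu (l + j))).le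
          rw [e]
          linarith
      _ ≤ u l ^ (s - 1) * (A * u l) := by
          rw [← Finset.mul_sum]
          exact mul_le_mul_of_nonneg_left (h l N) (Real.rpow_pos_of_pos (hu l) _).le
      _ = A * u l ^ s := by
          rw [Real.rpow_sub_one (hu l).ne']
          field_simp [(hu l).ne']
      _ ≤ _ := by
          gcongr
          have : 0 < A / s := by positivity
          linarith

theorem StronglyRegularWith.rpow {M : ℕ → ℝ} {A s : ℝ} (hM : StronglyRegularWith M A)
    (hs : 0 < s) : StronglyRegularWith (fun j => M j ^ s) (A ^ s + (A + A / s)) := by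
  obtain ⟨hpos, h0, hmono, hlc, hA, hmg, hsnq⟩ := hM
  have hA0 : 0 < A := by linarith
  have hAs : 0 < A / s := by positivity
  have hAs' : 0 < A ^ s := by positivity
  refine ⟨fun j => Real.rpow_pos_of_pos (hpos j) s, by simp [h0],
    fun i j hij => Real.rpow_le_rpow (hpos i).le (hmono hij) hs.le, fun j => ?_, by linarith,
    fun j k => ?_, fun l N => ?_⟩
  · dsimp only
    rw [← Real.mul_rpow (hpos _).le (hpos _).le, ← Real.mul_rpow (hpos _).le (hpos _).le]
    exact Real.rpow_le_rpow (mul_pos (hpos _) (hpos _)).le (hlc j) hs.le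
  · calc M (j + k) ^ s ≤ (A ^ (j + k) * (M j * M k)) ^ s :=
          Real.rpow_le_rpow (hpos _).le (hmg j k) hs.le
      _ = (A ^ s) ^ (j + k) * (M j ^ s * M k ^ s) := by
          rw [Real.mul_rpow (by positivity) (mul_pos (hpos j) (hpos k)).le,
            Real.mul_rpow (hpos j).le (hpos k).le, Real.rpow_pow_comm hA0.le]
      _ ≤ _ := by
          have := mul_pos (Real.rpow_pos_of_pos (hpos j) s) (Real.rpow_pos_of_pos (hpos k) s)
          gcongr
          linarith
  · have hanti : Antitone fun j => M j / M (j + 1) :=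
      antitone_nat_of_succ_le fun j => by
        rw [div_le_div_iff₀ (hpos _) (hpos _)]
        exact hlc j
    have hw (j : ℕ) : (0 : ℝ) < ((j : ℝ) + 1)⁻¹ := by positivity
    have key := sum_mul_rpow_le_of_sum_le_of_antitone (w := fun j => ((j : ℝ) + 1)⁻¹)
      (fun j => div_pos (hpos j) (hpos (j + 1))) hanti hw hA0 hs (fun l N => by
        refine le_of_eq_of_le (Finset.sum_congr rfl fun j _ => ?_) (hsnq l N)
        rw [mul_comm, ← div_eq_mul_inv, div_div, mul_comm (M _)]) l N
    dsimp only at key ⊢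
    rw [← Real.div_rpow (hpos _).le (hpos _).le]
    calc _ = ∑ j ∈ Finset.range N, (((l + j : ℕ) : ℝ) + 1)⁻¹ *
            (M (l + j) / M (l + j + 1)) ^ s := by
          refine Finset.sum_congr rfl fun j _ => ?_
          rw [Real.div_rpow (hpos _).le (hpos _).le, mul_comm _ (_ / _), ← div_eq_mul_inv,
            div_div, mul_comm (M _ ^ s)]
      _ ≤ _ := key
      _ ≤ _ := by
          have := Real.rpow_pos_of_pos (div_pos (hpos l) (hpos (l + 1))) s
          exact mul_le_mul_of_nonneg_right (by linarith) this.le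

theorem ciInf_rpow {ι : Type*} [Nonempty ι] {f : ι → ℝ} (hf : ∀ i, 0 ≤ f i) {s : ℝ}
    (hs : 0 < s) : ⨅ i, f i ^ s = (⨅ i, f i) ^ s := by
  have hf' (i : ι) : 0 ≤ f i ^ s := Real.rpow_nonneg (hf i) s
  have hbdd : BddBelow (Set.range f) := ⟨0, Set.forall_mem_range.2 hf⟩
  have hbdd' : BddBelow (Set.range fun i => f i ^ s) := ⟨0, Set.forall_mem_range.2 hf'⟩
  refine le_antisymm ?_ (le_ciInf fun i =>
    Real.rpow_le_rpow (Real.iInf_nonneg hf) (ciInf_le hbdd i) hs.le)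
  rw [← Real.rpow_inv_le_iff_of_pos (Real.iInf_nonneg hf') (Real.iInf_nonneg hf) hs]
  refine le_ciInf fun i => ?_
  rw [Real.rpow_inv_le_iff_of_pos (Real.iInf_nonneg hf') (hf i) hs]
  exact ciInf_le hbdd' i

theorem hfn_rpow {M : ℕ → ℝ} (hM : ∀ j, 0 ≤ M j) {s t : ℝ} (hs : 0 < s) (ht : 0 ≤ t) :
    hfn (fun j => M j ^ s) (t ^ s) = hfn M t ^ s := by
  rcases ht.eq_or_lt with rfl | ht'
  · simp [hfn, Real.zero_rpow hs.ne']
  · rw [hfn, hfn, if_neg (Real.rpow_pos_of_pos ht' s).ne', if_neg ht'.ne',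
      ← ciInf_rpow (fun j => mul_nonneg (pow_nonneg ht j) (hM j)) hs]
    refine iInf_congr fun j => ?_
    rw [Real.mul_rpow (pow_nonneg ht j) (hM j), Real.rpow_pow_comm ht]

/-- for strongly regular `M` and real `s > 0`, the sequence `M^s` is
strongly regular and `h_{M^s}(t^s) = (h_M(t))^s` for all `t ≥ 0`. -/
theorem stmt4 (M : ℕ → ℝ) (hM : StronglyRegular M) (s : ℝ) (hs : 0 < s) :
    StronglyRegular (fun j => M j ^ s) ∧
      ∀ t : ℝ, 0 ≤ t → hfn (fun j => M j ^ s) (t ^ s) = hfn M t ^ s := by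
  obtain ⟨A, hA⟩ := hM
  exact ⟨⟨_, hA.rpow hs⟩, fun t ht => hfn_rpow (fun j => (hA.1 j).le) hs ht⟩
end
end

section
/- Let M = (M_j)_{j≥0} be a strongly regular sequence. Then the set of γ > 0 for which M satisfies property (P_γ) is nonempty and bounded above; consequently the growth index γ(M) = sup{γ > 0 : M satisfies (P_γ)} is well defined and satisfies 0 < γ(M) < ∞. -/
noncomputable section

open Filter MeasureTheory
open scoped Topology

namespace StronglyRegularWith

variable {M : ℕ → ℝ} {A : ℝ}

theorem quotient_pos (h : StronglyRegularWith M A) (j : ℕ) : 0 < M (j + 1) / M j :=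
  div_pos (h.1 _) (h.1 _)

theorem quotient_monotone (h : StronglyRegularWith M A) :
    Monotone fun j => M (j + 1) / M j := by
  refine monotone_nat_of_le_succ fun j => ?_
  rw [div_le_div_iff₀ (h.1 _) (h.1 _)]
  linarith [h.2.2.2.1 j]

theorem mul_quotient_pow_le (h : StronglyRegularWith M A) (j k : ℕ) :
    M j * (M (j + 1) / M j) ^ k ≤ M (j + k) := by
  induction k with
  | zero => simp
  | succ k ih =>
    have hmono : M (j + 1) / M j ≤ M (j + k + 1) / M (j + k) :=
      h.quotient_monotone (Nat.le_add_right j k)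
    calc M j * (M (j + 1) / M j) ^ (k + 1)
        = M j * (M (j + 1) / M j) ^ k * (M (j + 1) / M j) := by ring
      _ ≤ M (j + k) * (M (j + k + 1) / M (j + k)) :=
        mul_le_mul ih hmono (h.quotient_pos j).le (h.1 _).le
      _ = M (j + (k + 1)) := mul_div_cancel₀ _ (h.1 _).ne'

theorem le_quotient_pow (h : StronglyRegularWith M A) (j : ℕ) :
    M j ≤ (M (j + 1) / M j) ^ j := by
  induction j with
  | zero => simp [h.2.1]
  | succ j ih =>
    have hmono : M (j + 1) / M j ≤ M (j + 1 + 1) / M (j + 1) :=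
      h.quotient_monotone (Nat.le_succ j)
    calc M (j + 1) = M j * (M (j + 1) / M j) := (mul_div_cancel₀ _ (h.1 _).ne').symm
      _ ≤ (M (j + 1) / M j) ^ j * (M (j + 1) / M j) :=
        mul_le_mul_of_nonneg_right ih (h.quotient_pos j).le
      _ = (M (j + 1) / M j) ^ (j + 1) := (pow_succ _ _).symm
      _ ≤ _ := pow_le_pow_left₀ (h.quotient_pos j).le hmono _

theorem quotient_two_mul_le (h : StronglyRegularWith M A) {j : ℕ} (hj : j ≠ 0) :
    M (2 * j + 1) / M (2 * j) ≤ A ^ 3 * (M (j + 1) / M j) := by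
  have hA : 0 ≤ A := zero_le_one.trans h.2.2.2.2.1
  have hmg := h.2.2.2.2.2.1
  have hq : (M (2 * j + 1) / M (2 * j)) ^ (2 * j) ≤ A ^ (4 * j) * M (2 * j) := by
    refine le_of_mul_le_mul_left ?_ (h.1 (2 * j))
    calc _ ≤ M (2 * j + 2 * j) := h.mul_quotient_pow_le _ _
      _ ≤ A ^ (2 * j + 2 * j) * (M (2 * j) * M (2 * j)) := hmg _ _
      _ = _ := by rw [show 2 * j + 2 * j = 4 * j by ring]; ring
  refine (pow_le_pow_iff_left₀ (h.quotient_pos _).le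
    (mul_nonneg (by positivity) (h.quotient_pos _).le) (n := 2 * j) (by omega)).1 ?_
  calc _ ≤ A ^ (4 * j) * M (2 * j) := hq
    _ ≤ A ^ (4 * j) * (A ^ (2 * j) * (M j * M j)) := by
      have := hmg j j
      rw [← two_mul] at this
      gcongr
    _ ≤ A ^ (4 * j) * (A ^ (2 * j) *
          ((M (j + 1) / M j) ^ j * (M (j + 1) / M j) ^ j)) := by
      have h1 := h.le_quotient_pow j
      have h2 := (h.1 j).le
      have h3 := (h.quotient_pos j).le
      gcongr
    _ = _ := by rw [mul_pow]; ring

theorem quotient_two_pow_le (h : StronglyRegularWith M A) (k : ℕ) :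
    M (2 ^ k + 1) / M (2 ^ k) ≤ (A ^ 3) ^ k * (M 2 / M 1) := by
  have hA : 0 ≤ A := zero_le_one.trans h.2.2.2.2.1
  induction k with
  | zero => simp
  | succ k ih =>
    rw [pow_succ', pow_succ' (A ^ 3), mul_assoc]
    exact (h.quotient_two_mul_le (by positivity)).trans
      (mul_le_mul_of_nonneg_left ih (by positivity))

theorem two_rpow_le_of_propertyP (h : StronglyRegularWith M A) {γ : ℝ} (hγ : 0 < γ)
    (hP : PropertyP M γ) : (2 : ℝ) ^ γ ≤ A ^ 3 := by
  obtain ⟨m', a, ha, hpos, hmono, hm⟩ := hP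
  have hA : 0 < A := zero_lt_one.trans_le h.2.2.2.2.1
  by_contra! hlt
  have hbound (k : ℕ) : ((2 : ℝ) ^ γ / A ^ 3) ^ k ≤ a * (M 2 / M 1) / m' 0 := by
    have h0 : m' 0 ≤ ((2 ^ k : ℕ) + 1 : ℝ) ^ (-γ) * m' (2 ^ k) := by
      simpa using hmono (Nat.zero_le (2 ^ k))
    have hb : (0 : ℝ) < (2 ^ k : ℕ) + 1 := by positivity
    rw [Real.rpow_neg hb.le, inv_mul_eq_div, le_div_iff₀ (by positivity)] at h0
    have hpow : ((2 : ℝ) ^ γ) ^ k ≤ ((2 ^ k : ℕ) + 1 : ℝ) ^ γ := by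
      rw [Real.rpow_pow_comm zero_le_two]
      exact Real.rpow_le_rpow (by positivity) (by push_cast; linarith) hγ.le
    have hup : m' (2 ^ k) ≤ a * ((A ^ 3) ^ k * (M 2 / M 1)) :=
      (hm _).2.trans (mul_le_mul_of_nonneg_left (h.quotient_two_pow_le k) (by linarith))
    rw [div_pow, div_le_div_iff₀ (by positivity) (hpos 0)]
    calc _ ≤ ((2 ^ k : ℕ) + 1 : ℝ) ^ γ * m' 0 :=
          mul_le_mul_of_nonneg_right hpow (hpos 0).le
      _ ≤ _ := by linarith
  obtain ⟨k, hk⟩ := pow_unbounded_of_one_lt (a * (M 2 / M 1) / m' 0)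
    ((one_lt_div (by positivity)).2 hlt)
  exact (hbound k).not_gt hk

/-- The summand of the strong non-quasianalyticity condition. -/
def nqTerm (M : ℕ → ℝ) (j : ℕ) : ℝ := M j / ((j + 1 : ℝ) * M (j + 1))

/-- The tails of the series in the strong non-quasianalyticity condition. -/
def nqTail (M : ℕ → ℝ) (l : ℕ) : ℝ := ∑' j, nqTerm M (l + j)

theorem nqTerm_pos (h : StronglyRegularWith M A) (j : ℕ) : 0 < nqTerm M j :=
  div_pos (h.1 _) (mul_pos (by positivity) (h.1 _))

theorem sum_nqTerm_le (h : StronglyRegularWith M A) (l N : ℕ) :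
    ∑ j ∈ Finset.range N, nqTerm M (l + j) ≤ A * (M l / M (l + 1)) :=
  h.2.2.2.2.2.2 l N

theorem summable_nqTerm (h : StronglyRegularWith M A) (l : ℕ) :
    Summable fun j => nqTerm M (l + j) :=
  summable_of_sum_range_le (fun _ => (h.nqTerm_pos _).le) (h.sum_nqTerm_le l)

theorem nqTail_le (h : StronglyRegularWith M A) (l : ℕ) :
    nqTail M l ≤ A * (M l / M (l + 1)) :=
  Real.tsum_le_of_sum_range_le (fun _ => (h.nqTerm_pos _).le) (h.sum_nqTerm_le l)

theorem sum_le_nqTail (h : StronglyRegularWith M A) (l N : ℕ) :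
    ∑ j ∈ Finset.range N, nqTerm M (l + j) ≤ nqTail M l :=
  (h.summable_nqTerm l).sum_le_tsum _ fun _ _ => (h.nqTerm_pos _).le

theorem nqTail_pos (h : StronglyRegularWith M A) (l : ℕ) : 0 < nqTail M l :=
  (h.nqTerm_pos l).trans_le (by simpa using h.sum_le_nqTail l 1)

theorem nqTail_eq (h : StronglyRegularWith M A) (l : ℕ) :
    nqTail M l = nqTerm M l + nqTail M (l + 1) := by
  rw [nqTail, (h.summable_nqTerm l).tsum_eq_zero_add, nqTail]
  simp only [add_zero, add_assoc, add_comm 1]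

theorem le_nqTail (h : StronglyRegularWith M A) (l : ℕ) :
    (2 * A ^ 3)⁻¹ * (M l / M (l + 1)) ≤ nqTail M l := by
  have hA : 1 ≤ A := h.2.2.2.2.1
  have hA3 : 1 ≤ A ^ 3 := one_le_pow₀ hA
  rcases eq_or_ne l 0 with rfl | hl
  · have h1 : nqTerm M 0 ≤ nqTail M 0 := by simpa using h.sum_le_nqTail 0 1
    refine le_trans ?_ h1
    have : (2 * A ^ 3)⁻¹ ≤ 1 := inv_le_one_of_one_le₀ (by linarith)
    simpa [nqTerm] using mul_le_mul_of_nonneg_right this (div_pos (h.1 0) (h.1 1)).le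
  · have hl' : (0 : ℝ) < l := by positivity
    refine le_trans ?_ (h.sum_le_nqTail l l)
    have hterm : ∀ j ∈ Finset.range l,
        (2 * l : ℝ)⁻¹ * ((A ^ 3)⁻¹ * (M l / M (l + 1))) ≤ nqTerm M (l + j) := by
      intro j hj
      have hj := Finset.mem_range.1 hj
      have hq : M (l + j + 1) / M (l + j) ≤ A ^ 3 * (M (l + 1) / M l) :=
        le_trans (h.quotient_monotone (show l + j ≤ 2 * l by omega)) (h.quotient_two_mul_le hl)
      have hc : ((l + j : ℕ) + 1 : ℝ) ≤ 2 * l := by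
        exact_mod_cast (show l + j + 1 ≤ 2 * l by omega)
      have hprod := mul_le_mul hc hq (h.quotient_pos _).le (by positivity)
      have hinv := inv_anti₀ (mul_pos (by positivity) (h.quotient_pos (l + j))) hprod
      calc _ = (2 * (l : ℝ) * (A ^ 3 * (M (l + 1) / M l)))⁻¹ := by simp only [mul_inv, inv_div]
        _ ≤ _ := hinv
        _ = nqTerm M (l + j) := by
          rw [nqTerm, mul_inv, inv_div, div_mul_eq_div_div_swap, inv_mul_eq_div]
    have hsum := Finset.card_nsmul_le_sum _ _ _ hterm
    rw [Finset.card_range, nsmul_eq_mul] at hsum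
    refine le_of_eq_of_le ?_ hsum
    have := h.1 (l + 1)
    field_simp

theorem rpow_mul_nqTail_succ_le (h : StronglyRegularWith M A) (l : ℕ) :
    ((l : ℝ) + 2) ^ A⁻¹ * nqTail M (l + 1) ≤ ((l : ℝ) + 1) ^ A⁻¹ * nqTail M l := by
  have hA : 1 ≤ A := h.2.2.2.2.1
  have hA0 : 0 < A := by linarith
  have hl : (0 : ℝ) < l + 1 := by positivity
  set x : ℝ := A⁻¹ * ((l : ℝ) + 1)⁻¹ with hx
  have hdecay : nqTail M (l + 1) ≤ (1 - x) * nqTail M l := by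
    have hle : x * nqTail M l ≤ nqTerm M l := by
      calc x * nqTail M l ≤ x * (A * (M l / M (l + 1))) :=
            mul_le_mul_of_nonneg_left (h.nqTail_le l) (by positivity)
        _ = nqTerm M l := by
          have := h.1 (l + 1)
          rw [hx, nqTerm]; field_simp
    linarith [h.nqTail_eq l]
  have hbern : ((l : ℝ) + 2) ^ A⁻¹ ≤ ((l : ℝ) + 1) ^ A⁻¹ * (1 + x) := by
    have hs : (l : ℝ) + 2 = (l + 1) * (1 + ((l : ℝ) + 1)⁻¹) := by field_simp; ring
    have hi : 0 < ((l : ℝ) + 1)⁻¹ := by positivity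
    rw [hs, Real.mul_rpow hl.le (by positivity)]
    exact mul_le_mul_of_nonneg_left (rpow_one_add_le_one_add_mul_self (by linarith)
      (by positivity) (inv_le_one_of_one_le₀ hA)) (by positivity)
  have hp : 0 < ((l : ℝ) + 1) ^ A⁻¹ := by positivity
  have hx0 : 0 < x := by positivity
  calc _ ≤ ((l : ℝ) + 1) ^ A⁻¹ * (1 + x) * ((1 - x) * nqTail M l) :=
        mul_le_mul hbern hdecay (h.nqTail_pos _).le (by positivity)
    _ = ((l : ℝ) + 1) ^ A⁻¹ * nqTail M l - x ^ 2 * (((l : ℝ) + 1) ^ A⁻¹ * nqTail M l) := by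
      ring
    _ ≤ _ := sub_le_self _ (mul_nonneg (sq_nonneg x) (mul_pos hp (h.nqTail_pos l)).le)

theorem propertyP_inv (h : StronglyRegularWith M A) : PropertyP M A⁻¹ := by
  have hA : 1 ≤ A := h.2.2.2.2.1
  have hA0 : 0 < A := by linarith
  have hA3 : A ≤ A ^ 3 := le_self_pow₀ hA (by norm_num)
  refine ⟨fun j => (nqTail M j)⁻¹, 2 * A ^ 3, by linarith,
    fun j => inv_pos.2 (h.nqTail_pos j), ?_, fun j => ⟨?_, ?_⟩⟩
  · refine monotone_nat_of_le_succ fun j => ?_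
    have hj : (0 : ℝ) ≤ (j : ℝ) + 1 := by positivity
    have hj' : (0 : ℝ) ≤ (j : ℝ) + 2 := by positivity
    have hcast : ((j + 1 : ℕ) : ℝ) + 1 = j + 2 := by push_cast; ring
    simp only [hcast]
    rw [Real.rpow_neg hj, Real.rpow_neg hj', ← mul_inv, ← mul_inv]
    exact inv_anti₀ (mul_pos (by positivity) (h.nqTail_pos _)) (h.rpow_mul_nqTail_succ_le j)
  · have hle : nqTail M j ≤ 2 * A ^ 3 * (M j / M (j + 1)) :=
      (h.nqTail_le j).trans
        (mul_le_mul_of_nonneg_right (by linarith) (div_pos (h.1 _) (h.1 _)).le)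
    rw [← inv_div (M j), ← mul_inv]
    exact inv_anti₀ (h.nqTail_pos j) hle
  · have hq := div_pos (h.1 j) (h.1 (j + 1))
    have := inv_anti₀ (mul_pos (by positivity) hq) (h.le_nqTail j)
    rwa [mul_inv, inv_inv, inv_div] at this

end StronglyRegularWith

/-- for a strongly regular sequence `M`, the set of `γ > 0` satisfying
`(P_γ)` is nonempty and bounded above, and the growth index
`γ(M) = sup {γ > 0 : (P_γ) holds}` satisfies `0 < γ(M) < ∞`. -/
theorem stmt6 (M : ℕ → ℝ) (hM : StronglyRegular M) :
    ({γ : ℝ | 0 < γ ∧ PropertyP M γ}).Nonempty ∧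
      BddAbove {γ : ℝ | 0 < γ ∧ PropertyP M γ} ∧
      0 < growthIndex M := by
  obtain ⟨A, h⟩ := hM
  have hA : 0 < A := zero_lt_one.trans_le h.2.2.2.2.1
  have hmem : A⁻¹ ∈ {γ : ℝ | 0 < γ ∧ PropertyP M γ} := ⟨inv_pos.2 hA, h.propertyP_inv⟩
  have hbdd : BddAbove {γ : ℝ | 0 < γ ∧ PropertyP M γ} :=
    ⟨Real.logb 2 (A ^ 3), fun γ hγ => (Real.le_logb_iff_rpow_le one_lt_two (by positivity)).2
      (h.two_rpow_le_of_propertyP hγ.1 hγ.2)⟩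
  exact ⟨⟨_, hmem⟩, hbdd, (inv_pos.2 hA).trans_le (le_csSup hbdd hmem)⟩
end
end

section
/- Let M = (M_j)_{j≥0} be a strongly regular sequence and let γ be a real number with 0 < γ < γ(M). Then there exist a constant a ≥ 1 and a strongly regular sequence M' = (M'_j)_{j≥0} such that the sequence ((j!)^{-γ} M'_j)_{j≥0} is strongly regular and a^{-j} M_j ≤ M'_j ≤ a^j M_j for every j ∈ ℕ. -/
noncomputable section

open Filter MeasureTheory
open scoped Topology

/-- A discrete form of `∫_k^{k+1} x^{-1-ε} dx = (k^{-ε} - (k+1)^{-ε}) / ε`. -/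
lemma rpow_neg_div_le_sub {ε x : ℝ} (hε : 0 < ε) (hx : 1 ≤ x) :
    x ^ (-ε) / x ≤ (2 + ε) / ε * (x ^ (-ε) - (x + 1) ^ (-ε)) := by
  have hx0 : 0 < x := by linarith
  have hx1 : 0 < x + 1 := by linarith
  have hlog : 1 / (x + 1) ≤ Real.log ((x + 1) / x) := by
    have h := Real.one_sub_inv_le_log_of_pos (div_pos hx1 hx0)
    have e : 1 - ((x + 1) / x)⁻¹ = 1 / (x + 1) := by field_simp; ring
    linarith
  have hpow : 1 + ε / (x + 1) ≤ ((x + 1) / x) ^ ε := by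
    rw [Real.rpow_def_of_pos (div_pos hx1 hx0)]
    have h := Real.add_one_le_exp (Real.log ((x + 1) / x) * ε)
    have h2 := mul_le_mul_of_nonneg_right hlog hε.le
    have e : 1 / (x + 1) * ε = ε / (x + 1) := by ring
    linarith
  have hinv : (x + 1) ^ (-ε) ≤ x ^ (-ε) * (1 + ε / (x + 1))⁻¹ := by
    have e : (x + 1) ^ (-ε) = x ^ (-ε) * (((x + 1) / x) ^ ε)⁻¹ := by
      rw [Real.div_rpow hx1.le hx0.le, Real.rpow_neg hx1.le, Real.rpow_neg hx0.le]
      have := (Real.rpow_pos_of_pos hx0 ε).ne'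
      have := (Real.rpow_pos_of_pos hx1 ε).ne'
      field_simp
    rw [e]
    gcongr
  have hkey : 1 / x ≤ (2 + ε) / ε * (1 - (1 + ε / (x + 1))⁻¹) := by
    have e : (2 + ε) / ε * (1 - (1 + ε / (x + 1))⁻¹) = (2 + ε) / (x + 1 + ε) := by
      have : x + 1 + ε ≠ 0 := by positivity
      field_simp
      ring
    rw [e, div_le_div_iff₀ hx0 (by positivity)]
    nlinarith
  have hxp : 0 < x ^ (-ε) := Real.rpow_pos_of_pos hx0 _
  have hC : 0 < (2 + ε) / ε := by positivity
  calc x ^ (-ε) / x = x ^ (-ε) * (1 / x) := by ring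
    _ ≤ x ^ (-ε) * ((2 + ε) / ε * (1 - (1 + ε / (x + 1))⁻¹)) := by gcongr
    _ = (2 + ε) / ε * (x ^ (-ε) - x ^ (-ε) * (1 + ε / (x + 1))⁻¹) := by ring
    _ ≤ (2 + ε) / ε * (x ^ (-ε) - (x + 1) ^ (-ε)) := by gcongr

lemma sum_rpow_neg_div_le {ε : ℝ} (hε : 0 < ε) (ℓ N : ℕ) :
    ∑ j ∈ Finset.range N, ((ℓ + j : ℕ) + 1 : ℝ) ^ (-ε) / ((ℓ + j : ℕ) + 1 : ℝ) ≤
      (2 + ε) / ε * ((ℓ : ℝ) + 1) ^ (-ε) := by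
  have h : ∑ j ∈ Finset.range N, ((ℓ + j : ℕ) + 1 : ℝ) ^ (-ε) / ((ℓ + j : ℕ) + 1 : ℝ) ≤
      (2 + ε) / ε * (((ℓ : ℝ) + 1) ^ (-ε) - ((ℓ + N : ℕ) + 1 : ℝ) ^ (-ε)) := by
    induction N with
    | zero => simp
    | succ N ih =>
      rw [Finset.sum_range_succ]
      have h := rpow_neg_div_le_sub hε (x := ((ℓ + N : ℕ) + 1 : ℝ)) (by simp; positivity)
      have e : ((ℓ + (N + 1) : ℕ) + 1 : ℝ) = ((ℓ + N : ℕ) + 1 : ℝ) + 1 := by push_cast; ring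
      rw [e]
      linarith
  refine h.trans ?_
  gcongr
  have : (0 : ℝ) ≤ ((ℓ + N : ℕ) + 1 : ℝ) ^ (-ε) := by positivity
  linarith

/-- A sequence of moderate growth whose quotients `q` satisfy `1 ≤ q 0` and grow at least like
`(j + 1) ^ ε`, in the sense that `(j + 1) ^ (-ε) * q j` is monotone, is strongly regular. -/
lemma stronglyRegular_of_quotients {Q q : ℕ → ℝ} {ε B : ℝ} (hε : 0 < ε) (hQ0 : Q 0 = 1)
    (hQ : ∀ j, Q (j + 1) = Q j * q j) (hq0 : 1 ≤ q 0)
    (hmono : Monotone fun j : ℕ => ((j : ℝ) + 1) ^ (-ε) * q j) (hB : 1 ≤ B)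
    (hmg : ∀ j k : ℕ, Q (j + k) ≤ B ^ (j + k) * (Q j * Q k)) : StronglyRegular Q := by
  have hq (j : ℕ) : q j = ((j : ℝ) + 1) ^ ε * (((j : ℝ) + 1) ^ (-ε) * q j) := by
    rw [← mul_assoc, ← Real.rpow_add (by positivity)]
    simp
  have hp (j : ℕ) : 1 ≤ ((j : ℝ) + 1) ^ (-ε) * q j := by
    have h := hmono (Nat.zero_le j)
    simp only [Nat.cast_zero, zero_add, Real.one_rpow, one_mul] at h
    linarith
  have hqmono : Monotone q := by
    intro i j hij
    have h := hmono hij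
    have hi := hp i
    rw [hq i, hq j]
    have : (i : ℝ) ≤ j := by exact_mod_cast hij
    dsimp only at h
    gcongr
  have hq1 (j : ℕ) : 1 ≤ q j := hq0.trans (hqmono (Nat.zero_le j))
  have hqpos (j : ℕ) : 0 < q j := by linarith [hq1 j]
  have hQpos (j : ℕ) : 0 < Q j := by
    induction j with
    | zero => simp [hQ0]
    | succ j ih => rw [hQ]; exact mul_pos ih (hqpos j)
  have hC : 0 < (2 + ε) / ε := by positivity
  refine ⟨B + (2 + ε) / ε, hQpos, hQ0, ?_, ?_, by linarith, ?_, ?_⟩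
  · refine monotone_nat_of_le_succ fun j => ?_
    rw [hQ]
    exact le_mul_of_one_le_right (hQpos j).le (hq1 j)
  · intro j
    have h := mul_le_mul_of_nonneg_left (hqmono (Nat.le_succ j))
      (mul_pos (hQpos j) (hQpos (j + 1))).le
    calc Q (j + 1) * Q (j + 1) = Q j * Q (j + 1) * q j := by rw [hQ j]; ring
      _ ≤ Q j * Q (j + 1) * q (j + 1) := h
      _ = Q j * Q (j + 2) := by rw [hQ (j + 1)]; ring
  · intro j k
    refine (hmg j k).trans ?_
    have := hQpos j
    have := hQpos k
    gcongr
    linarith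
  · intro ℓ N
    set y : ℝ := ((ℓ : ℝ) + 1) ^ (-ε) with hy
    have hypos : 0 < y := by positivity
    have hterm (j : ℕ) : Q (ℓ + j) / (((ℓ + j : ℕ) + 1 : ℝ) * Q (ℓ + j + 1)) ≤
        (y * q ℓ)⁻¹ * (((ℓ + j : ℕ) + 1 : ℝ) ^ (-ε) / ((ℓ + j : ℕ) + 1 : ℝ)) := by
      have h := hmono (Nat.le_add_right ℓ j)
      dsimp only at h
      rw [← hy] at h
      have h1 := hQpos (ℓ + j)
      have h2 := hqpos (ℓ + j)
      have h3 := hqpos ℓ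
      have e : Q (ℓ + j) / (((ℓ + j : ℕ) + 1 : ℝ) * Q (ℓ + j + 1)) =
          1 / ((((ℓ + j : ℕ) : ℝ) + 1) * q (ℓ + j)) := by
        rw [hQ]
        field_simp
      rw [e]
      have hx : (0 : ℝ) < ((ℓ + j : ℕ) : ℝ) + 1 := by positivity
      generalize ((ℓ + j : ℕ) : ℝ) + 1 = x at *
      calc 1 / (x * q (ℓ + j)) = (y * q ℓ)⁻¹ * (y * q ℓ / (x * q (ℓ + j))) := by field_simp
        _ ≤ (y * q ℓ)⁻¹ * (x ^ (-ε) * q (ℓ + j) / (x * q (ℓ + j))) := by gcongr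
        _ = (y * q ℓ)⁻¹ * (x ^ (-ε) / x) := by
          congr 1
          field_simp
    calc _ ≤ ∑ j ∈ Finset.range N, (y * q ℓ)⁻¹ *
          (((ℓ + j : ℕ) + 1 : ℝ) ^ (-ε) / ((ℓ + j : ℕ) + 1 : ℝ)) :=
          Finset.sum_le_sum fun j _ => hterm j
      _ ≤ (y * q ℓ)⁻¹ * ((2 + ε) / ε * y) := by
          rw [← Finset.mul_sum]
          have := hqpos ℓ
          exact mul_le_mul_of_nonneg_left (sum_rpow_neg_div_le hε ℓ N) (by positivity)
      _ = (2 + ε) / ε * (Q ℓ / Q (ℓ + 1)) := by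
          rw [hQ]
          have := hqpos ℓ
          have := hQpos ℓ
          field_simp
      _ ≤ (B + (2 + ε) / ε) * (Q ℓ / Q (ℓ + 1)) := by
          have := div_pos (hQpos ℓ) (hQpos (ℓ + 1))
          gcongr
          linarith

/-- Sequences whose quotients are comparable are equivalent. -/
lemma le_pow_mul_of_quotients_le {P Q p q : ℕ → ℝ} {a : ℝ} (ha : 0 ≤ a) (h0 : P 0 = Q 0)
    (hPs : ∀ j, P (j + 1) = P j * p j) (hQs : ∀ j, Q (j + 1) = Q j * q j)
    (hQ : ∀ j, 0 < Q j) (hp : ∀ j, 0 < p j) (hpq : ∀ j, p j ≤ a * q j) (j : ℕ) :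
    P j ≤ a ^ j * Q j := by
  induction j with
  | zero => simp [h0]
  | succ j ih =>
    have h1 := (hp j).le
    have h2 := (hQ j).le
    calc P (j + 1) = P j * p j := hPs j
      _ ≤ a ^ j * Q j * (a * q j) := mul_le_mul ih (hpq j) h1 (by positivity)
      _ = a ^ (j + 1) * Q (j + 1) := by rw [hQs]; ring

/-- Moderate growth passes to equivalent sequences. -/
lemma moderateGrowth_of_equiv {P Q : ℕ → ℝ} {A a : ℝ} (hA : 0 ≤ A) (ha : 0 ≤ a)
    (hP : ∀ j, 0 < P j) (hPQ : ∀ j, P j ≤ a ^ j * Q j) (hQP : ∀ j, Q j ≤ a ^ j * P j)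
    (hmg : ∀ j k : ℕ, P (j + k) ≤ A ^ (j + k) * (P j * P k)) (j k : ℕ) :
    Q (j + k) ≤ (a * A * a) ^ (j + k) * (Q j * Q k) := by
  have h := mul_le_mul (hPQ j) (hPQ k) (hP k).le ((hP j).le.trans (hPQ j))
  calc Q (j + k) ≤ a ^ (j + k) * P (j + k) := hQP _
    _ ≤ a ^ (j + k) * (A ^ (j + k) * (P j * P k)) := by gcongr; exact hmg j k
    _ ≤ a ^ (j + k) * (A ^ (j + k) * (a ^ j * Q j * (a ^ k * Q k))) := by gcongr
    _ = (a * A * a) ^ (j + k) * (Q j * Q k) := by ring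

/-- for strongly regular `M` and `0 < γ < γ(M)` there exist `a ≥ 1` and a
strongly regular sequence `M'` such that `((j!)^{-γ} M'_j)_j` is strongly regular and
`a^{-j} M_j ≤ M'_j ≤ a^j M_j` for every `j`. -/
theorem stmt8 (M : ℕ → ℝ) (hM : StronglyRegular M) (γ : ℝ) (hγ0 : 0 < γ)
    (hγ : γ < growthIndex M) :
    ∃ (a : ℝ) (M' : ℕ → ℝ), 1 ≤ a ∧ StronglyRegular M' ∧
      StronglyRegular (fun j => (Nat.factorial j : ℝ) ^ (-γ) * M' j) ∧
      ∀ j : ℕ, M j / a ^ j ≤ M' j ∧ M' j ≤ a ^ j * M j := by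
  obtain ⟨A, hMpos, hM0, -, -, hA, hmg, -⟩ := hM
  have hne : {γ : ℝ | 0 < γ ∧ PropertyP M γ}.Nonempty := by
    by_contra h
    rw [Set.not_nonempty_iff_eq_empty] at h
    rw [growthIndex, h, Real.sSup_empty] at hγ
    linarith
  obtain ⟨δ, ⟨hδ, m', b, hb, hm', hmono, hcomp⟩, hγδ⟩ := exists_lt_of_lt_csSup hne hγ
  have hs := hm' 0
  have hs' : 0 < (m' 0)⁻¹ := inv_pos.2 hs
  set s := m' 0
  have hss : 1 ≤ s + s⁻¹ := by
    rcases le_total 1 s with h | h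
    · linarith
    · linarith [(one_le_inv₀ hs).2 h]
  set n : ℕ → ℝ := fun j => m' j * s⁻¹ with hn
  have hnpos (j : ℕ) : 0 < n j := mul_pos (hm' j) hs'
  have hn0 : n 0 = 1 := mul_inv_cancel₀ hs.ne'
  have hnmono : Monotone fun j : ℕ => ((j : ℝ) + 1) ^ (-δ) * n j := by
    have h := hmono.mul_const hs'.le
    simpa only [hn, mul_assoc] using h
  set M' : ℕ → ℝ := fun j => ∏ i ∈ Finset.range j, n i with hM'
  have hM's (j : ℕ) : M' (j + 1) = M' j * n j := Finset.prod_range_succ _ _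
  have hM'0 : M' 0 = 1 := Finset.prod_range_zero _
  have hM'pos (j : ℕ) : 0 < M' j := Finset.prod_pos fun i _ => hnpos i
  set a := b * (s + s⁻¹) with ha_def
  have ha : 1 ≤ a := one_le_mul_of_one_le_of_one_le hb hss
  have ha0 : 0 < a := by linarith
  have hb0 : 0 < b := by linarith
  have hMs (j : ℕ) : M (j + 1) = M j * (M (j + 1) / M j) :=
    (mul_div_cancel₀ _ (hMpos j).ne').symm
  have hmpos (j : ℕ) : 0 < M (j + 1) / M j := div_pos (hMpos _) (hMpos _)
  have hle1 : ∀ j, M' j ≤ a ^ j * M j := by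
    refine le_pow_mul_of_quotients_le ha0.le (by rw [hM'0, hM0]) hM's hMs hMpos hnpos fun j => ?_
    have hm := hmpos j
    calc n j ≤ b * (M (j + 1) / M j) * s⁻¹ :=
          mul_le_mul_of_nonneg_right (hcomp j).2 hs'.le
      _ = b * s⁻¹ * (M (j + 1) / M j) := by ring
      _ ≤ a * (M (j + 1) / M j) := by
          rw [ha_def]
          gcongr
          linarith
  have hle2 : ∀ j, M j ≤ a ^ j * M' j := by
    refine le_pow_mul_of_quotients_le ha0.le (by rw [hM'0, hM0]) hMs hM's hM'pos hmpos fun j => ?_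
    have hnj := hnpos j
    calc M (j + 1) / M j ≤ b * m' j := (inv_mul_le_iff₀ hb0).1 (hcomp j).1
      _ = b * s * n j := by
          simp only [hn]
          field_simp
      _ ≤ a * n j := by
          rw [ha_def]
          gcongr
          linarith
  have hmg' := moderateGrowth_of_equiv (zero_le_one.trans hA) ha0.le hMpos hle2 hle1 hmg
  have hB : 1 ≤ a * A * a :=
    one_le_mul_of_one_le_of_one_le (one_le_mul_of_one_le_of_one_le ha hA) ha
  refine ⟨a, M', ha, stronglyRegular_of_quotients hδ hM'0 hM's hn0.ge hnmono hB hmg', ?_,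
    fun j => ⟨?_, hle1 j⟩⟩
  · refine stronglyRegular_of_quotients (q := fun j => ((j : ℝ) + 1) ^ (-γ) * n j)
      (sub_pos.2 hγδ) (by simp [hM'0]) (fun j => ?_) (by simp [hn0]) ?_ hB fun j k => ?_
    · rw [hM's, Nat.factorial_succ, Nat.cast_mul,
        Real.mul_rpow (Nat.cast_nonneg _) (Nat.cast_nonneg _)]
      push_cast
      ring
    · convert hnmono using 2 with j
      rw [← mul_assoc, ← Real.rpow_add (by positivity)]
      ring_nf
    · have hf : ((j + k).factorial : ℝ) ^ (-γ) ≤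
          (j.factorial : ℝ) ^ (-γ) * (k.factorial : ℝ) ^ (-γ) := by
        rw [← Real.mul_rpow (Nat.cast_nonneg _) (Nat.cast_nonneg _)]
        refine Real.rpow_le_rpow_of_nonpos (by positivity) ?_ (by linarith)
        exact_mod_cast Nat.le_of_dvd (Nat.factorial_pos _)
          (Nat.factorial_mul_factorial_dvd_factorial_add j k)
      calc ((j + k).factorial : ℝ) ^ (-γ) * M' (j + k)
          ≤ ((j.factorial : ℝ) ^ (-γ) * (k.factorial : ℝ) ^ (-γ)) *
            ((a * A * a) ^ (j + k) * (M' j * M' k)) :=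
            mul_le_mul hf (hmg' j k) (hM'pos _).le (by positivity)
        _ = _ := by ring
  · rw [div_le_iff₀' (by positivity)]
    exact hle2 j
end
end

section
/- Let N = (N_j)_{j≥0} be a strongly regular sequence with growth index γ(N) > 1. Then there exist a function F holomorphic in the right half-plane S₁ = {w ∈ ℂ : Re w > 0} and constants b₅ > 0, b₆ > 0, b₇ > 0, depending only on N, such that b₅ · h_N(b₆ · Re w) ≤ |F(w)| ≤ h_N(b₇ · |w|) for every w ∈ S₁. -/
noncomputable section

open Filter MeasureTheory
open scoped Topology

lemma mul_rpow_neg_add_one_le_sub {s x : ℝ} (hs : 0 < s) (hx : 0 < x) :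
    s * (x + 1) ^ (-(s + 1)) ≤ x ^ (-s) - (x + 1) ^ (-s) := by
  have hx1 : 0 < x + 1 := by linarith
  have hy : 0 < x / (x + 1) := by positivity
  have hlog := Real.log_le_sub_one_of_pos hy
  have hexp := Real.add_one_le_exp (Real.log (x / (x + 1)) * (-s))
  rw [← Real.rpow_def_of_pos hy, Real.div_rpow hx.le hx1.le] at hexp
  have hq : x / (x + 1) - 1 = -(x + 1)⁻¹ := by field_simp; ring
  rw [hq] at hlog
  have hle : 1 + s * (x + 1)⁻¹ ≤ x ^ (-s) / (x + 1) ^ (-s) := by nlinarith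
  rw [le_div_iff₀ (by positivity)] at hle
  have hsplit : (x + 1) ^ (-(s + 1)) = (x + 1) ^ (-s) * (x + 1)⁻¹ := by
    rw [← Real.rpow_neg_one (x + 1), ← Real.rpow_add hx1]
    ring_nf
  rw [hsplit]
  linarith

lemma sum_range_rpow_neg_add_one_le {s x : ℝ} (hs : 0 < s) (hx : 1 ≤ x) (n : ℕ) :
    ∑ i ∈ Finset.range n, (x + i) ^ (-(s + 1)) ≤ (1 + s⁻¹) * x ^ (-s) := by
  have hx0 : 0 < x := by linarith
  have htail : s * ∑ i ∈ Finset.range n, (x + (i + 1 : ℕ)) ^ (-(s + 1)) ≤ x ^ (-s) := by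
    rw [Finset.mul_sum]
    calc _ ≤ ∑ i ∈ Finset.range n, ((x + i) ^ (-s) - (x + (i + 1 : ℕ)) ^ (-s)) := by
          refine Finset.sum_le_sum fun i _ => ?_
          have := mul_rpow_neg_add_one_le_sub hs (x := x + i) (by positivity)
          push_cast
          rwa [← add_assoc]
      _ = (x + (0 : ℕ)) ^ (-s) - (x + n) ^ (-s) :=
          Finset.sum_range_sub' (fun i : ℕ => (x + i) ^ (-s)) n
      _ ≤ x ^ (-s) := by
          have : 0 ≤ (x + n) ^ (-s) := by positivity
          simpa using this
  have hhead : x ^ (-(s + 1)) ≤ x ^ (-s) := Real.rpow_le_rpow_of_exponent_le hx (by linarith)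
  calc _ ≤ ∑ i ∈ Finset.range (n + 1), (x + i) ^ (-(s + 1)) :=
        Finset.sum_le_sum_of_subset_of_nonneg (by simp) fun i _ _ => by positivity
    _ = ∑ i ∈ Finset.range n, (x + (i + 1 : ℕ)) ^ (-(s + 1)) + x ^ (-(s + 1)) := by
        rw [Finset.sum_range_succ']; simp
    _ ≤ s⁻¹ * x ^ (-s) + x ^ (-s) := by
        gcongr
        rwa [inv_mul_eq_div, le_div_iff₀' hs]
    _ = _ := by ring

lemma PropertyP.exists_sum_le {M : ℕ → ℝ} (hM : ∀ j, 0 < M j) {γ : ℝ} (hγ : 1 < γ)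
    (h : PropertyP M γ) :
    ∃ D : ℝ, 0 < D ∧ ∀ k n : ℕ, ∑ i ∈ Finset.range n, M (k + i) / M (k + i + 1) ≤
      D * (k + 1) * (M k / M (k + 1)) := by
  obtain ⟨m, a, ha, hm, hmono, hcomp⟩ := h
  obtain ⟨s, rfl⟩ : ∃ s, γ = s + 1 := ⟨γ - 1, by ring⟩
  have hs : 0 < s := by linarith
  have ha0 : 0 < a := by linarith
  refine ⟨a ^ 2 * (1 + s⁻¹), by positivity, fun k n => ?_⟩
  have hk : (0 : ℝ) < (k : ℝ) + 1 := by positivity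
  have hquot : ∀ j, M j / M (j + 1) ≤ a * (m j)⁻¹ := fun j => by
    have h1 := (hcomp j).2
    have h2 := hM j
    have h3 := hM (j + 1)
    have h4 := hm j
    rw [← div_eq_mul_inv, div_le_div_iff₀ h3 h4]
    rw [← mul_div_assoc, le_div_iff₀ h2] at h1
    linarith
  have hquot' : (m k)⁻¹ ≤ a * (M k / M (k + 1)) := by
    have h1 := (hcomp k).1
    have h2 := hM k
    have h3 := hM (k + 1)
    have h4 := hm k
    have := inv_anti₀ (by positivity) h1
    simpa [mul_comm] using this
  have hterm : ∀ i : ℕ, M (k + i) / M (k + i + 1) ≤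
      a ^ 2 * ((k : ℝ) + 1) ^ (s + 1) * (M k / M (k + 1)) *
        ((k : ℝ) + 1 + i) ^ (-(s + 1)) := fun i => by
    have h1 := hmono (Nat.le_add_right k i)
    simp only [Nat.cast_add] at h1
    rw [show (k : ℝ) + i + 1 = k + 1 + i by ring, Real.rpow_neg hk.le] at h1
    have hp : (0 : ℝ) < ((k : ℝ) + 1 + i) ^ (-(s + 1)) := by positivity
    have hq : (0 : ℝ) < ((k : ℝ) + 1) ^ (s + 1) := by positivity
    have h2 : (m (k + i))⁻¹ ≤
        ((k : ℝ) + 1) ^ (s + 1) * (m k)⁻¹ * ((k : ℝ) + 1 + i) ^ (-(s + 1)) := by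
      have h3 := hm k
      have h4 := hm (k + i)
      have := inv_anti₀ (by positivity) h1
      rw [mul_inv, mul_inv, inv_inv, inv_mul_le_iff₀ hp] at this
      linarith
    calc _ ≤ a * (m (k + i))⁻¹ := hquot _
      _ ≤ a * (((k : ℝ) + 1) ^ (s + 1) * (a * (M k / M (k + 1))) *
            ((k : ℝ) + 1 + i) ^ (-(s + 1))) := by
          gcongr
          exact h2.trans (by gcongr)
      _ = _ := by ring
  have hMk : 0 < M k / M (k + 1) := div_pos (hM _) (hM _)
  calc _ ≤ ∑ i ∈ Finset.range n, a ^ 2 * ((k : ℝ) + 1) ^ (s + 1) * (M k / M (k + 1)) *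
        ((k : ℝ) + 1 + i) ^ (-(s + 1)) := Finset.sum_le_sum fun i _ => hterm i
    _ ≤ a ^ 2 * ((k : ℝ) + 1) ^ (s + 1) * (M k / M (k + 1)) *
        ((1 + s⁻¹) * ((k : ℝ) + 1) ^ (-s)) := by
        rw [← Finset.mul_sum]
        gcongr
        exact sum_range_rpow_neg_add_one_le hs (by simp) n
    _ = a ^ 2 * (1 + s⁻¹) * (((k : ℝ) + 1) ^ (s + 1) * ((k : ℝ) + 1) ^ (-s)) *
        (M k / M (k + 1)) := by ring
    _ = _ := by
        rw [← Real.rpow_add hk]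
        simp

lemma exists_prod_one_add_mul_le {c : ℕ → ℝ} (hc : ∀ j, 0 < c j) {D : ℝ} (hD : 0 < D)
    (hsum : ∀ k n : ℕ, ∑ i ∈ Finset.range n, c (k + i) ≤ D * (k + 1) * c k)
    (hlim : Filter.Tendsto c Filter.atTop (nhds 0)) {x : ℝ} (hx : 0 < x) :
    ∃ k : ℕ, ∀ n, k ≤ n → ∏ i ∈ Finset.range n, (1 + x * c i) ≤
      Real.exp D * ((2 * Real.exp D * x) ^ k * ∏ i ∈ Finset.range k, c i) := by
  classical
  have hex : ∃ k, x * c k ≤ 1 := by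
    have h0 : Filter.Tendsto (fun j => x * c j) Filter.atTop (nhds 0) := by
      simpa using hlim.const_mul x
    exact (h0.eventually_le_const one_pos).exists
  refine ⟨Nat.find hex, fun n hn => ?_⟩
  have hfind := Nat.find_spec hex
  have hmin : ∀ i < Nat.find hex, 1 < x * c i := fun i hi => not_le.mp (Nat.find_min hex hi)
  generalize Nat.find hex = k at *
  obtain ⟨l, rfl⟩ := Nat.exists_eq_add_of_le hn
  have hpos : ∀ i, 0 < 1 + x * c i := fun i => by have := hc i; positivity
  have h1 : ∏ i ∈ Finset.range k, (1 + x * c i) ≤ (2 * x) ^ k * ∏ i ∈ Finset.range k, c i := by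
    calc _ ≤ ∏ i ∈ Finset.range k, (2 * x * c i) := by
          refine Finset.prod_le_prod (fun i _ => (hpos i).le) fun i hi => ?_
          have := hmin i (Finset.mem_range.mp hi)
          linarith
      _ = _ := by rw [Finset.prod_mul_distrib]; simp
  have h2 : ∏ i ∈ Finset.range l, (1 + x * c (k + i)) ≤ Real.exp (D * (k + 1)) := by
    calc _ ≤ ∏ i ∈ Finset.range l, Real.exp (x * c (k + i)) := by
          refine Finset.prod_le_prod (fun i _ => (hpos _).le) fun i _ => ?_
          rw [add_comm]
          exact Real.add_one_le_exp _
      _ = Real.exp (x * ∑ i ∈ Finset.range l, c (k + i)) := by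
          rw [← Real.exp_sum, Finset.mul_sum]
      _ ≤ _ := by
          refine Real.exp_le_exp.mpr ?_
          calc _ ≤ x * (D * (k + 1) * c k) := by gcongr; exact hsum k l
            _ = D * (k + 1) * (x * c k) := by ring
            _ ≤ D * (k + 1) := mul_le_of_le_one_right (by positivity) hfind
  rw [Finset.prod_range_add]
  have hprod : 0 < ∏ i ∈ Finset.range k, c i := Finset.prod_pos fun i _ => hc i
  calc _ ≤ (2 * x) ^ k * (∏ i ∈ Finset.range k, c i) * Real.exp (D * (k + 1)) :=
        mul_le_mul h1 h2 (Finset.prod_nonneg fun i _ => (hpos _).le) (by positivity)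
    _ = _ := by
        rw [show D * ((k : ℝ) + 1) = k * D + D by ring, Real.exp_add, Real.exp_nat_mul]
        ring

lemma differentiable_tprod_one_add_mul {c : ℕ → ℝ} (hc : Summable fun j => |c j|) :
    Differentiable ℂ fun z : ℂ => ∏' j, (1 + z * c j) := by
  intro z
  set r := ‖z‖ + 1
  have hprod : HasProdLocallyUniformlyOn (fun j (z : ℂ) => 1 + z * c j)
      (fun z => ∏' j, (1 + z * c j)) (Metric.ball 0 r) := by
    refine (hc.mul_left r).hasProdLocallyUniformlyOn_nat_one_add Metric.isOpen_ball
      (.of_forall fun j w hw => ?_) fun j => by fun_prop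
    rw [norm_mul, Complex.norm_real, Real.norm_eq_abs]
    gcongr
    exact (mem_ball_zero_iff.mp hw).le
  have hdiff := hprod.tendstoLocallyUniformlyOn_finsetRange.differentiableOn
    (.of_forall fun n => by fun_prop) Metric.isOpen_ball
  exact hdiff.differentiableAt (Metric.isOpen_ball.mem_nhds (by simp [r]))

lemma one_le_norm_one_add_mul {z : ℂ} (hz : 0 ≤ z.re) {c : ℝ} (hc : 0 ≤ c) :
    1 ≤ ‖1 + z * c‖ := by
  refine le_trans ?_ (Complex.re_le_norm _)
  simpa using mul_nonneg hz hc

lemma norm_mul_le_norm_one_add_mul {z : ℂ} (hz : 0 ≤ z.re) {c : ℝ} (hc : 0 ≤ c) :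
    ‖z‖ * c ≤ ‖1 + z * c‖ := by
  have hnorm : ‖z‖ * c = ‖z * c‖ := by simp [abs_of_nonneg hc]
  rw [hnorm, ← sq_le_sq₀ (norm_nonneg _) (norm_nonneg _), Complex.sq_norm, Complex.sq_norm,
    Complex.normSq_apply, Complex.normSq_apply]
  have := mul_nonneg hz hc
  simp
  nlinarith

lemma pow_mul_prod_le_norm_prod_one_add_mul {c : ℕ → ℝ} (hc : ∀ j, 0 ≤ c j) {z : ℂ}
    (hz : 0 ≤ z.re) {k n : ℕ} (hkn : k ≤ n) :
    ‖z‖ ^ k * ∏ i ∈ Finset.range k, c i ≤ ‖∏ i ∈ Finset.range n, (1 + z * c i)‖ := by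
  obtain ⟨l, rfl⟩ := Nat.exists_eq_add_of_le hkn
  rw [norm_prod, Finset.prod_range_add]
  calc _ = (∏ i ∈ Finset.range k, ‖z‖ * c i) * 1 := by rw [Finset.prod_mul_distrib]; simp
    _ ≤ _ := by
        refine mul_le_mul ?_ ?_ zero_le_one (Finset.prod_nonneg fun i _ => norm_nonneg _)
        · exact Finset.prod_le_prod (fun i _ => mul_nonneg (norm_nonneg _) (hc i))
            fun i _ => norm_mul_le_norm_one_add_mul hz (hc i)
        · exact Finset.one_le_prod fun i _ => one_le_norm_one_add_mul hz (hc _)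

lemma norm_prod_one_add_mul_le {c : ℕ → ℝ} (hc : ∀ j, 0 ≤ c j) {z : ℂ} {x : ℝ}
    (hz : ‖z‖ ≤ x) (n : ℕ) :
    ‖∏ i ∈ Finset.range n, (1 + z * c i)‖ ≤ ∏ i ∈ Finset.range n, (1 + x * c i) := by
  rw [norm_prod]
  refine Finset.prod_le_prod (fun i _ => norm_nonneg _) fun i _ => ?_
  calc _ ≤ 1 + ‖z‖ * c i := by
        refine (norm_add_le _ _).trans_eq ?_
        simp [abs_of_nonneg (hc i)]
    _ ≤ _ := by gcongr; exact hc i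

lemma hfn_le {M : ℕ → ℝ} (hM : ∀ j, 0 < M j) {t : ℝ} (ht : 0 < t) (k : ℕ) :
    hfn M t ≤ t ^ k * M k := by
  rw [hfn, if_neg ht.ne']
  refine ciInf_le ⟨0, ?_⟩ k
  rintro _ ⟨j, rfl⟩
  have := hM j
  positivity

lemma le_hfn_s11 {M : ℕ → ℝ} {t b : ℝ} (ht : 0 < t) (h : ∀ k, b ≤ t ^ k * M k) : b ≤ hfn M t := by
  rw [hfn, if_neg ht.ne']
  exact le_ciInf h

lemma exists_propertyP_of_lt_growthIndex {M : ℕ → ℝ} {β : ℝ} (hβ : 0 ≤ β)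
    (h : β < growthIndex M) : ∃ γ, β < γ ∧ PropertyP M γ := by
  rw [growthIndex] at h
  have hne : {γ : ℝ | 0 < γ ∧ PropertyP M γ}.Nonempty := by
    by_contra hne
    rw [Set.not_nonempty_iff_eq_empty.mp hne, Real.sSup_empty] at h
    linarith
  obtain ⟨γ, hγ, hlt⟩ := exists_lt_of_lt_csSup hne h
  exact ⟨γ, hlt, hγ.2⟩

/-- for strongly regular `N` with `γ(N) > 1` there exist a function `F`
holomorphic in the right half-plane `S₁ = {Re w > 0}` and constants `b₅, b₆, b₇ > 0`
such that `b₅ h_N(b₆ Re w) ≤ |F(w)| ≤ h_N(b₇ |w|)` for every `w ∈ S₁`. -/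
theorem stmt11 (N : ℕ → ℝ) (hN : StronglyRegular N) (hγ : 1 < growthIndex N) :
    ∃ (F : ℂ → ℂ) (b₅ b₆ b₇ : ℝ), 0 < b₅ ∧ 0 < b₆ ∧ 0 < b₇ ∧
      DifferentiableOn ℂ F {w : ℂ | 0 < w.re} ∧
      ∀ w : ℂ, 0 < w.re →
        b₅ * hfn N (b₆ * w.re) ≤ ‖F w‖ ∧ ‖F w‖ ≤ hfn N (b₇ * ‖w‖) := by
  obtain ⟨-, hpos, hzero, -⟩ := hN
  obtain ⟨γ, hγ1, hP⟩ := exists_propertyP_of_lt_growthIndex zero_le_one hγ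
  obtain ⟨D, hD, hsum⟩ := hP.exists_sum_le hpos hγ1
  set c : ℕ → ℝ := fun j => N j / N (j + 1) with hc_def
  have hc : ∀ j, 0 < c j := fun j => div_pos (hpos _) (hpos _)
  have hcs : Summable c := summable_of_sum_range_le (fun j => (hc j).le) fun n => by
    simpa using hsum 0 n
  have hcabs : Summable fun j => |c j| := hcs.abs
  have hprod : ∀ k, ∏ i ∈ Finset.range k, c i = (N k)⁻¹ := fun k => by
    induction k with
    | zero => simp [hzero]
    | succ k ih =>
      rw [Finset.prod_range_succ, ih, hc_def]
      have := (hpos k).ne'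
      field_simp
  set P : ℂ → ℂ := fun z => ∏' j, (1 + z * c j)
  have hPlim : ∀ z : ℂ, Filter.Tendsto (fun n => ‖∏ i ∈ Finset.range n, (1 + z * c i)‖)
      Filter.atTop (nhds ‖P z‖) := fun z => by
    have hm : Multipliable fun j => 1 + z * (c j : ℂ) := by
      refine multipliable_one_add_of_summable ?_
      simpa using hcabs.mul_left ‖z‖
    exact hm.hasProd.tendsto_prod_nat.norm
  have hPge : ∀ z : ℂ, 0 ≤ z.re → ∀ k, ‖z‖ ^ k * (N k)⁻¹ ≤ ‖P z‖ := fun z hz k => by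
    refine ge_of_tendsto (hPlim z) (Filter.eventually_atTop.mpr ⟨k, fun n hn => ?_⟩)
    rw [← hprod]
    exact pow_mul_prod_le_norm_prod_one_add_mul (fun j => (hc j).le) hz hn
  have hPle : ∀ (z : ℂ) (x : ℝ), 0 < x → ‖z‖ ≤ x →
      ∃ k : ℕ, ‖P z‖ ≤ Real.exp D * ((2 * Real.exp D * x) ^ k * (N k)⁻¹) := fun z x hx hzx => by
    obtain ⟨k, hk⟩ := exists_prod_one_add_mul_le hc hD hsum hcs.tendsto_atTop_zero hx
    refine ⟨k, le_of_tendsto (hPlim z) (Filter.eventually_atTop.mpr ⟨k, fun n hn => ?_⟩)⟩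
    rw [← hprod]
    exact (norm_prod_one_add_mul_le (fun j => (hc j).le) hzx n).trans (hk n hn)
  have hre : ∀ w : ℂ, 0 < w.re → 0 ≤ (w⁻¹).re := fun w hw => by
    rw [Complex.inv_re]
    exact div_nonneg hw.le (Complex.normSq_nonneg _)
  have hPone : ∀ w : ℂ, 0 < w.re → 1 ≤ ‖P w⁻¹‖ := fun w hw => by
    simpa [hzero] using hPge w⁻¹ (hre w hw) 0
  have hne : ∀ w : ℂ, 0 < w.re → w ≠ 0 := fun w hw h => by simp [h] at hw
  refine ⟨fun w => (P w⁻¹)⁻¹, Real.exp (-D), (2 * Real.exp D)⁻¹, 1, by positivity,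
    by positivity, one_pos, ?_, fun w hw => ⟨?_, ?_⟩⟩
  · intro w hw
    have hd : DifferentiableAt ℂ (fun w : ℂ => P w⁻¹) w :=
      DifferentiableAt.comp w (differentiable_tprod_one_add_mul hcabs _)
        (differentiableAt_inv (hne w hw))
    refine (hd.inv ?_).differentiableWithinAt
    exact norm_pos_iff.mp (one_pos.trans_le (hPone w hw))
  · obtain ⟨k, hk⟩ := hPle w⁻¹ w.re⁻¹ (by positivity) (by
      rw [norm_inv]
      exact inv_anti₀ hw (Complex.re_le_norm w))
    have hle := inv_anti₀ (one_pos.trans_le (hPone w hw)) hk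
    rw [norm_inv]
    refine le_trans ?_ hle
    calc _ ≤ Real.exp (-D) * (((2 * Real.exp D)⁻¹ * w.re) ^ k * N k) := by
          gcongr
          exact hfn_le hpos (by positivity) k
      _ = _ := by
          simp [Real.exp_neg, mul_pow]
          ring
  · have hw0 : 0 < ‖w‖ := norm_pos_iff.mpr (hne w hw)
    rw [one_mul]
    refine le_hfn_s11 hw0 fun k => ?_
    have hNk := hpos k
    have hle := hPge w⁻¹ (hre w hw) k
    rw [norm_inv, inv_pow, ← mul_inv] at hle
    simpa using inv_anti₀ (by positivity) hle
end
end

section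
/- Let M = (M_j)_{j≥0} be a strongly regular sequence and let γ be a real number with 0 < γ < γ(M). Then there exists a constant b₉ > 0 such that for every ℓ ∈ ℕ, ∑_{j≥ℓ} ( M_j/((j+1) M_{j+1}) )^{1/(γ+1)} ≤ b₉ · (ℓ+1) · ( M_ℓ/((ℓ+1) M_{ℓ+1}) )^{1/(γ+1)}. -/
noncomputable section

open Filter MeasureTheory
open scoped Topology

/-- Mean value estimate for `x ↦ x ^ (-q)` on `[x, x + 1]`. -/
theorem mul_rpow_add_one_le_rpow_sub {q x : ℝ} (hq : 0 < q) (hx : 0 < x) :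
    q * (x + 1) ^ (-q - 1) ≤ x ^ (-q) - (x + 1) ^ (-q) := by
  have hy : 0 < x + 1 := by linarith
  have hlog : 1 / (x + 1) ≤ Real.log (x + 1) - Real.log x := by
    have h := Real.one_sub_inv_le_log_of_pos (div_pos hy hx)
    rw [Real.log_div hy.ne' hx.ne', inv_div] at h
    have h1 : 1 - x / (x + 1) = 1 / (x + 1) := by field_simp; ring
    linarith
  have hpow : x ^ (-q) = (x + 1) ^ (-q) * Real.exp (q * (Real.log (x + 1) - Real.log x)) := by
    rw [Real.rpow_def_of_pos hx, Real.rpow_def_of_pos hy, ← Real.exp_add]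
    congr 1
    ring
  have hexp : 1 + q * (1 / (x + 1)) ≤ Real.exp (q * (Real.log (x + 1) - Real.log x)) := by
    have h := Real.add_one_le_exp (q * (Real.log (x + 1) - Real.log x))
    have h2 := mul_le_mul_of_nonneg_left hlog hq.le
    linarith
  have hpos : 0 < (x + 1) ^ (-q) := Real.rpow_pos_of_pos hy _
  have hmul := mul_le_mul_of_nonneg_left hexp hpos.le
  rw [hpow, Real.rpow_sub_one hy.ne']
  have hring : q * ((x + 1) ^ (-q) / (x + 1)) =
      (x + 1) ^ (-q) * (1 + q * (1 / (x + 1))) - (x + 1) ^ (-q) := by ring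
  linarith

theorem rpow_neg_le_mul_rpow_sub {q x : ℝ} (hq : 0 < q) (hx : 1 ≤ x) :
    x ^ (-q - 1) ≤ 2 ^ (q + 1) / q * (x ^ (-q) - (x + 1) ^ (-q)) := by
  have hx0 : 0 < x := by linarith
  have hle : (2 * x) ^ (-q - 1) ≤ (x + 1) ^ (-q - 1) :=
    Real.rpow_le_rpow_of_nonpos (by linarith) (by linarith) (by linarith)
  rw [Real.mul_rpow (by norm_num) hx0.le] at hle
  have h2 : (2 : ℝ) ^ (q + 1) * 2 ^ (-q - 1) = 1 := by
    rw [← Real.rpow_add (by norm_num), show q + 1 + (-q - 1) = 0 by ring, Real.rpow_zero]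
  calc x ^ (-q - 1) = 2 ^ (q + 1) * (2 ^ (-q - 1) * x ^ (-q - 1)) := by
        rw [← mul_assoc, h2, one_mul]
    _ ≤ 2 ^ (q + 1) * (x + 1) ^ (-q - 1) := by gcongr
    _ = 2 ^ (q + 1) / q * (q * (x + 1) ^ (-q - 1)) := by field_simp
    _ ≤ _ := by
        gcongr
        exact mul_rpow_add_one_le_rpow_sub hq hx0

/-- Tail estimate for the `p`-series with `p = q + 1 > 1`. -/
theorem sum_rpow_tail_le {q : ℝ} (hq : 0 < q) (ℓ N : ℕ) :
    ∑ j ∈ Finset.range N, (((ℓ + j : ℕ) : ℝ) + 1) ^ (-q - 1) ≤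
      2 ^ (q + 1) / q * ((ℓ : ℝ) + 1) ^ (-q) := by
  have hterm : ∀ j ∈ Finset.range N, (((ℓ + j : ℕ) : ℝ) + 1) ^ (-q - 1) ≤
      2 ^ (q + 1) / q * ((((ℓ + j : ℕ) : ℝ) + 1) ^ (-q) -
        (((ℓ + (j + 1) : ℕ) : ℝ) + 1) ^ (-q)) := by
    intro j _
    have h := rpow_neg_le_mul_rpow_sub hq
      (x := ((ℓ + j : ℕ) : ℝ) + 1) (by linarith [Nat.cast_nonneg (α := ℝ) (ℓ + j)])
    rwa [show ((ℓ + (j + 1) : ℕ) : ℝ) = ((ℓ + j : ℕ) : ℝ) + 1 by push_cast; ring]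
  refine (Finset.sum_le_sum hterm).trans ?_
  rw [← Finset.mul_sum, Finset.sum_range_sub' (fun j : ℕ => (((ℓ + j : ℕ) : ℝ) + 1) ^ (-q))]
  gcongr
  simp only [add_zero, sub_le_self_iff]
  positivity

/-- Property `(P_δ)` makes the quotients `M (j + 1) / M j` grow at least like `(j + 1) ^ δ`. -/
theorem PropertyP.exists_quotient_le {M : ℕ → ℝ} {δ : ℝ} (h : PropertyP M δ) :
    ∃ C : ℝ, 0 < C ∧ ∀ ℓ j : ℕ, ℓ ≤ j →
      ((j : ℝ) + 1) ^ δ * (M (ℓ + 1) / M ℓ) ≤ C * ((ℓ : ℝ) + 1) ^ δ * (M (j + 1) / M j) := by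
  obtain ⟨m', a, ha, -, hmono, hbd⟩ := h
  have ha0 : 0 < a := by linarith
  refine ⟨a * a, by positivity, fun ℓ j hℓj => ?_⟩
  have hj : 0 < (j : ℝ) + 1 := by positivity
  have hℓ : 0 < (ℓ : ℝ) + 1 := by positivity
  have hm := hmono hℓj
  simp only [Real.rpow_neg hj.le, Real.rpow_neg hℓ.le] at hm
  have hjp : 0 < ((j : ℝ) + 1) ^ δ := by positivity
  have hℓp : 0 < ((ℓ : ℝ) + 1) ^ δ := by positivity
  rw [inv_mul_eq_div, inv_mul_eq_div, div_le_div_iff₀ hℓp hjp] at hm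
  have hlow : M (ℓ + 1) / M ℓ ≤ a * m' ℓ := (inv_mul_le_iff₀ ha0).1 (hbd ℓ).1
  calc ((j : ℝ) + 1) ^ δ * (M (ℓ + 1) / M ℓ) ≤ ((j : ℝ) + 1) ^ δ * (a * m' ℓ) := by gcongr
    _ = a * (m' ℓ * ((j : ℝ) + 1) ^ δ) := by ring
    _ ≤ a * (m' j * ((ℓ : ℝ) + 1) ^ δ) := by gcongr
    _ ≤ a * (a * (M (j + 1) / M j) * ((ℓ : ℝ) + 1) ^ δ) := by
        gcongr
        exact (hbd j).2
    _ = _ := by ring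

/-- for strongly regular `M` and `0 < γ < γ(M)` there is `b₉ > 0` such
that for every `ℓ` (uniformly over partial sums, i.e. for the sum over `j ≥ ℓ`),
`∑_{j≥ℓ} (M_j/((j+1)M_{j+1}))^{1/(γ+1)} ≤ b₉ (ℓ+1) (M_ℓ/((ℓ+1)M_{ℓ+1}))^{1/(γ+1)}`. -/
theorem stmt12 (M : ℕ → ℝ) (hM : StronglyRegular M) (γ : ℝ) (hγ0 : 0 < γ)
    (hγ : γ < growthIndex M) :
    ∃ b₉ : ℝ, 0 < b₉ ∧ ∀ ℓ N : ℕ,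
      ∑ j ∈ Finset.range N,
          (M (ℓ + j) / (((ℓ + j : ℕ) + 1 : ℝ) * M (ℓ + j + 1))) ^ (1 / (γ + 1)) ≤
        b₉ * ((ℓ : ℝ) + 1) * (M ℓ / (((ℓ : ℝ) + 1) * M (ℓ + 1))) ^ (1 / (γ + 1)) := by
  have hpos : ∀ j, 0 < M j := by
    obtain ⟨A, hA⟩ := hM
    exact hA.1
  have hne : {γ : ℝ | 0 < γ ∧ PropertyP M γ}.Nonempty := by
    by_contra hemp
    rw [Set.not_nonempty_iff_eq_empty] at hemp
    rw [growthIndex, hemp, Real.sSup_empty] at hγ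
    linarith
  obtain ⟨δ, ⟨-, hP⟩, hγδ⟩ := exists_lt_of_lt_csSup hne hγ
  obtain ⟨C, hC, hquot⟩ := hP.exists_quotient_le
  set s : ℝ := 1 / (γ + 1) with hs
  have hs0 : 0 < s := by positivity
  set q : ℝ := (δ + 1) * s - 1 with hq_def
  have hq : 0 < q := by
    have : 1 < (δ + 1) * s := by
      rw [hs, mul_one_div, one_lt_div (by linarith)]
      linarith
    linarith
  refine ⟨C ^ s * (2 ^ (q + 1) / q), by positivity, fun ℓ N => ?_⟩
  have hℓ : 0 < (ℓ : ℝ) + 1 := by positivity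
  set r : ℝ := M ℓ / M (ℓ + 1) with hr_def
  have hr : 0 < r := div_pos (hpos _) (hpos _)
  have hterm : ∀ j ∈ Finset.range N,
      (M (ℓ + j) / (((ℓ + j : ℕ) + 1 : ℝ) * M (ℓ + j + 1))) ^ s ≤
        C ^ s * ((ℓ : ℝ) + 1) ^ (δ * s) * r ^ s * (((ℓ + j : ℕ) : ℝ) + 1) ^ (-q - 1) := by
    intro j _
    have hj : 0 < ((ℓ + j : ℕ) : ℝ) + 1 := by positivity
    have h := hquot ℓ (ℓ + j) (Nat.le_add_right _ _)
    have h1 := hpos (ℓ + j)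
    have h2 := hpos (ℓ + j + 1)
    have h3 := hpos ℓ
    have h4 := hpos (ℓ + 1)
    generalize ((ℓ + j : ℕ) : ℝ) + 1 = y at *
    have hbase : M (ℓ + j) / (y * M (ℓ + j + 1)) ≤
        C * ((ℓ : ℝ) + 1) ^ δ * r * y ^ (-(δ + 1)) := by
      rw [Real.rpow_neg hj.le, Real.rpow_add_one hj.ne', hr_def]
      have hyδ : 0 < y ^ δ := by positivity
      rw [← mul_div_assoc, ← mul_div_assoc, div_le_div_iff₀ h3 h1] at h
      rw [← mul_div_assoc, ← div_eq_mul_inv, div_div,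
        div_le_div_iff₀ (by positivity) (by positivity)]
      have := mul_le_mul_of_nonneg_left h hj.le
      linarith
    calc (M (ℓ + j) / (y * M (ℓ + j + 1))) ^ s
        ≤ (C * ((ℓ : ℝ) + 1) ^ δ * r * y ^ (-(δ + 1))) ^ s := by gcongr
      _ = C ^ s * ((ℓ : ℝ) + 1) ^ (δ * s) * r ^ s * y ^ (-q - 1) := by
        rw [Real.mul_rpow (by positivity) (by positivity),
          Real.mul_rpow (by positivity) (by positivity),
          Real.mul_rpow (by positivity) (by positivity),
          ← Real.rpow_mul hℓ.le, ← Real.rpow_mul hj.le,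
          show -(δ + 1) * s = -q - 1 by rw [hq_def]; ring]
  have hbase : M ℓ / (((ℓ : ℝ) + 1) * M (ℓ + 1)) = ((ℓ : ℝ) + 1)⁻¹ * r := by
    rw [hr_def, inv_mul_eq_div, div_div, mul_comm]
  have hexp : ((ℓ : ℝ) + 1) ^ (δ * s) * ((ℓ : ℝ) + 1) ^ (-q) =
      ((ℓ : ℝ) + 1) * ((ℓ : ℝ) + 1) ^ (-s) := by
    rw [← Real.rpow_add hℓ, ← Real.rpow_one_add' hℓ.le]
    · congr 1
      rw [hq_def]
      ring
    · have : s < 1 := by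
        rw [hs, div_lt_one (by linarith)]
        linarith
      linarith
  calc _ ≤ _ := Finset.sum_le_sum hterm
    _ ≤ C ^ s * ((ℓ : ℝ) + 1) ^ (δ * s) * r ^ s * (2 ^ (q + 1) / q * ((ℓ : ℝ) + 1) ^ (-q)) := by
        rw [← Finset.mul_sum]
        gcongr
        exact sum_rpow_tail_le hq ℓ N
    _ = C ^ s * (2 ^ (q + 1) / q) * r ^ s *
          (((ℓ : ℝ) + 1) ^ (δ * s) * ((ℓ : ℝ) + 1) ^ (-q)) := by ring
    _ = _ := by
        rw [hexp, hbase, Real.mul_rpow (by positivity) hr.le, Real.inv_rpow hℓ.le,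
          Real.rpow_neg hℓ.le]
        ring
end
end
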